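/- arXiv:1504.03431 — 2 statements merged into one kernel-verified Lean document; each statement's English description precedes it below -/
import Mathlib

section
/- The functions (λ,x) ↦ G_{n,λ}(x) converge uniformly on M × (ℂ^{k+1} \ {0}) as n → ∞ to a function G, and G is continuous on M × (ℂ^{k+1} \ {0}); in particular, for each λ ∈ M the function G_λ = G(λ,·) is continuous and, whenever λ_n → λ in M, G_{λ_n} → G_λ locally uniformly on ℂ^{k+1} \ {0}. -/
open Filter Topology

noncomputable section

/-- The fibered iterate `F_{σ^{n-1} lam} ∘ ⋯ ∘ F_{σ lam} ∘ F_lam`, with the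
`0`-th iterate being the identity. -/
def fiter {M : Type*} {E : Type*} (σ : M → M) (F : M → E → E) : ℕ → M → E → E
  | 0, _, x => x
  | n + 1, lam, x => fiter σ F n (σ lam) (F lam x)

end

theorem continuous_fiter {M E : Type*} [TopologicalSpace M] [TopologicalSpace E]
    {σ : M → M} (hσ : Continuous σ) {F : M → E → E}
    (hF : Continuous fun q : M × E => F q.1 q.2) (n : ℕ) :
    Continuous fun q : M × E => fiter σ F n q.1 q.2 := by
  induction n with
  | zero => exact continuous_snd
  | succ n ih => exact ih.comp ((hσ.comp continuous_fst).prodMk hF)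

theorem fiter_ne_zero {M E : Type*} [Zero E] {σ : M → M} {F : M → E → E}
    (hF : ∀ lam x, x ≠ 0 → F lam x ≠ 0) (n : ℕ) (lam : M) {x : E} (hx : x ≠ 0) :
    fiter σ F n lam x ≠ 0 := by
  induction n generalizing lam x with
  | zero => exact hx
  | succ n ih => exact ih (σ lam) (hF lam x hx)

theorem abs_log_norm_sub_le {E : Type*} [NormedAddCommGroup E] {l L : ℝ} (hl : 0 < l)
    (hlL : l ≤ L) {d : ℕ} {x y : E} (hx : x ≠ 0)
    (h : l * ‖x‖ ^ d ≤ ‖y‖ ∧ ‖y‖ ≤ L * ‖x‖ ^ d) :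
    |Real.log ‖y‖ - d * Real.log ‖x‖| ≤ max |Real.log l| |Real.log L| := by
  have hpow : 0 < ‖x‖ ^ d := pow_pos (norm_pos_iff.mpr hx) d
  have hlow : 0 < l * ‖x‖ ^ d := mul_pos hl hpow
  have h1 := Real.log_le_log hlow h.1
  have h2 := Real.log_le_log (hlow.trans_le h.1) h.2
  rw [Real.log_mul hl.ne' hpow.ne', Real.log_pow] at h1
  rw [Real.log_mul (hl.trans_le hlL).ne' hpow.ne', Real.log_pow] at h2
  exact abs_le_max_abs_abs (by linarith) (by linarith)

/-- Consecutive normalized log-norms of the fibered iterates differ by at most a geometric term. -/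
theorem abs_log_norm_fiter_succ_sub_le {M E : Type*} [NormedAddCommGroup E] {σ : M → M}
    {F : M → E → E} {d : ℕ} (hd : 0 < d) {C : ℝ} (hF0 : ∀ lam x, x ≠ 0 → F lam x ≠ 0)
    (hF : ∀ lam x, x ≠ 0 → |Real.log ‖F lam x‖ - d * Real.log ‖x‖| ≤ C)
    (n : ℕ) (lam : M) {x : E} (hx : x ≠ 0) :
    |1 / (d : ℝ) ^ (n + 1) * Real.log ‖fiter σ F (n + 1) lam x‖ -
        1 / (d : ℝ) ^ n * Real.log ‖fiter σ F n lam x‖| ≤ C / d * (1 / d) ^ n := by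
  have hd' : (0 : ℝ) < d := Nat.cast_pos.mpr hd
  induction n generalizing lam x with
  | zero =>
    have key : 1 / (d : ℝ) ^ (0 + 1) * Real.log ‖fiter σ F (0 + 1) lam x‖ -
        1 / (d : ℝ) ^ 0 * Real.log ‖fiter σ F 0 lam x‖ =
        (Real.log ‖F lam x‖ - d * Real.log ‖x‖) / d := by
      simp only [fiter]
      field_simp
      ring
    rw [key, abs_div, abs_of_pos hd', pow_zero, mul_one]
    exact div_le_div_of_nonneg_right (hF lam x hx) hd'.le
  | succ n ih =>
    have key : 1 / (d : ℝ) ^ (n + 1 + 1) * Real.log ‖fiter σ F (n + 1 + 1) lam x‖ -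
        1 / (d : ℝ) ^ (n + 1) * Real.log ‖fiter σ F (n + 1) lam x‖ =
        (1 / (d : ℝ) ^ (n + 1) * Real.log ‖fiter σ F (n + 1) (σ lam) (F lam x)‖ -
        1 / (d : ℝ) ^ n * Real.log ‖fiter σ F n (σ lam) (F lam x)‖) * (1 / d) := by
      simp only [fiter]
      ring
    rw [key, abs_mul, abs_of_pos (one_div_pos.mpr hd'), pow_succ (1 / (d : ℝ)), ← mul_assoc]
    exact mul_le_mul_of_nonneg_right (ih (σ lam) (hF0 lam x hx)) (one_div_pos.mpr hd').le

/-- A sequence of real functions with uniformly summable increments converges uniformly. -/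
theorem exists_tendstoUniformlyOn_of_summable_sub {α : Type*} {g : ℕ → α → ℝ} {u : ℕ → ℝ}
    (hu : Summable u) {s : Set α} (hg : ∀ n, ∀ q ∈ s, |g (n + 1) q - g n q| ≤ u n) :
    ∃ G : α → ℝ, TendstoUniformlyOn g G atTop s := by
  refine ⟨fun q => g 0 q + ∑' n, (g (n + 1) q - g n q), ?_⟩
  have h := tendstoUniformlyOn_tsum_nat (f := fun n q => g (n + 1) q - g n q) hu hg
  rw [Metric.tendstoUniformlyOn_iff] at h ⊢
  intro ε hε
  filter_upwards [h ε hε] with n hn q hq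
  have hq := hn q hq
  rw [Finset.sum_range_sub (fun n => g n q), Real.dist_eq] at hq
  rw [Real.dist_eq]
  convert hq using 2
  ring

/-- The functions `(lam, x) ↦ G_{n,lam}(x)` converge uniformly on
`M × (ℂ^{k+1} ∖ {0})` to a function `G` which is continuous there. -/
theorem statement16 {M : Type*} [MetricSpace M] [CompactSpace M]
    (σ : M → M) (hσ : Continuous σ) (k : ℕ) (hk : 1 ≤ k) (d : ℕ) (hd : 2 ≤ d)
    (F : M → EuclideanSpace ℂ (Fin (k + 1)) → EuclideanSpace ℂ (Fin (k + 1)))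
    (l L : ℝ) (hl : 0 < l) (hlL : l ≤ L)
    (hF : ∀ (lam : M) (x : EuclideanSpace ℂ (Fin (k + 1))),
      l * ‖x‖ ^ d ≤ ‖F lam x‖ ∧ ‖F lam x‖ ≤ L * ‖x‖ ^ d)
    (hFc : Continuous fun q : M × EuclideanSpace ℂ (Fin (k + 1)) => F q.1 q.2) :
    ∃ G : M → EuclideanSpace ℂ (Fin (k + 1)) → ℝ,
      ContinuousOn (fun q : M × EuclideanSpace ℂ (Fin (k + 1)) => G q.1 q.2)
        {q : M × EuclideanSpace ℂ (Fin (k + 1)) | q.2 ≠ 0} ∧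
      TendstoUniformlyOn
        (fun n (q : M × EuclideanSpace ℂ (Fin (k + 1))) =>
          (1 / (d : ℝ) ^ n) * Real.log ‖fiter σ F n q.1 q.2‖)
        (fun q => G q.1 q.2) atTop
        {q : M × EuclideanSpace ℂ (Fin (k + 1)) | q.2 ≠ 0} := by
  have hF0 : ∀ lam x, x ≠ 0 → F lam x ≠ 0 := fun lam x hx =>
    norm_pos_iff.mp ((mul_pos hl (pow_pos (norm_pos_iff.mpr hx) d)).trans_le (hF lam x).1)
  have hd1 : (1 : ℝ) / d < 1 := by
    rw [one_div]
    exact inv_lt_one_of_one_lt₀ (by exact_mod_cast hd)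
  obtain ⟨G, hG⟩ := exists_tendstoUniformlyOn_of_summable_sub
    (g := fun n (q : M × EuclideanSpace ℂ (Fin (k + 1))) =>
      (1 / (d : ℝ) ^ n) * Real.log ‖fiter σ F n q.1 q.2‖)
    ((summable_geometric_of_lt_one (by positivity) hd1).mul_left
      (max |Real.log l| |Real.log L| / d))
    (s := {q | q.2 ≠ 0})
    (fun n q hq => abs_log_norm_fiter_succ_sub_le (by omega) hF0
      (fun lam x hx => abs_log_norm_sub_le hl hlL hx (hF lam x)) n q.1 hq)
  refine ⟨fun lam x => G (lam, x), hG.continuousOn (Frequently.of_forall fun n => ?_), hG⟩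
  exact continuousOn_const.mul ((continuous_fiter hσ hFc n).norm.continuousOn.log
    fun q hq => norm_ne_zero_iff.mpr (fiter_ne_zero hF0 n q.1 hq))
end

section
/- Assume in addition that each F_λ is holomorphic (complex differentiable on ℂ^{k+1}) and homogeneous of degree d, i.e., F_λ(cx) = c^d F_λ(x) for all c ∈ ℂ and x ∈ ℂ^{k+1}. Then for every λ ∈ M the basin of attraction of the origin equals the negativity set of the Green function: A_λ = {x ∈ ℂ^{k+1} : G_λ(x) < 0}. -/
open Filter Topology

theorem fiter_succ_apply {M E : Type*} (σ : M → M) (F : M → E → E) (n : ℕ) (lam : M) (x : E) :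
    fiter σ F (n + 1) lam x = F (σ^[n] lam) (fiter σ F n lam x) := by
  induction n generalizing lam x with
  | zero => rfl
  | succ n ih => exact ih (σ lam) (F lam x)

/-- Real sequences with `u (n + 1) ≤ a + d * u n` that become very negative have a negative
exponential growth rate. -/
theorem neg_of_tendsto_div_pow_of_tendsto_atBot {d : ℝ} (hd : 1 < d) {a g : ℝ} {u : ℕ → ℝ}
    (hu : ∀ n, u (n + 1) ≤ a + d * u n) (hbot : Tendsto u atTop atBot)
    (hg : Tendsto (fun n => 1 / d ^ n * u n) atTop (𝓝 g)) : g < 0 := by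
  have hd0 : 0 < d := by linarith
  set c := a / (d - 1) with hc
  have hac : a + c = d * c := by
    rw [hc]
    have : d - 1 ≠ 0 := by linarith
    field_simp
    ring
  have hanti : Antitone fun n => 1 / d ^ n * (u n + c) := by
    refine antitone_nat_of_succ_le fun n => ?_
    calc 1 / d ^ (n + 1) * (u (n + 1) + c) ≤ 1 / d ^ (n + 1) * (d * (u n + c)) := by
          gcongr
          linarith [hu n]
      _ = 1 / d ^ n * (u n + c) := by
          field_simp
          ring
  have hpow : Tendsto (fun n : ℕ => 1 / d ^ n) atTop (𝓝 0) := by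
    simp_rw [one_div]
    exact (tendsto_pow_atTop_atTop_of_one_lt hd).inv_tendsto_atTop
  have hlim : Tendsto (fun n => 1 / d ^ n * (u n + c)) atTop (𝓝 g) := by
    simpa [mul_add] using hg.add (hpow.mul_const c)
  obtain ⟨N, hN⟩ := (hbot.eventually_lt_atBot (-c)).exists
  refine (hanti.le_of_tendsto hlim N).trans_lt ?_
  exact mul_neg_of_pos_of_neg (by positivity) (by linarith)

/-- Real sequences with a negative exponential growth rate tend to `-∞`. -/
theorem tendsto_atBot_of_tendsto_div_pow_neg {d : ℝ} (hd : 1 < d) {g : ℝ} {u : ℕ → ℝ}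
    (hg : Tendsto (fun n => 1 / d ^ n * u n) atTop (𝓝 g)) (hneg : g < 0) :
    Tendsto u atTop atBot := by
  have hd0 : 0 < d := by linarith
  refine ((tendsto_pow_atTop_atTop_of_one_lt hd).atTop_mul_neg hneg hg).congr fun n => ?_
  field_simp

/-- If each `F_lam` is holomorphic and homogeneous of degree `d`, then the basin of
attraction of the origin is exactly the set where the Green function is negative
(with the convention `G_lam(0) = -∞ < 0`). -/
theorem statement18 {M : Type*} [MetricSpace M] [CompactSpace M]
    (σ : M → M) (hσ : Continuous σ) (k : ℕ) (hk : 1 ≤ k) (d : ℕ) (hd : 2 ≤ d)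
    (F : M → EuclideanSpace ℂ (Fin (k + 1)) → EuclideanSpace ℂ (Fin (k + 1)))
    (l L : ℝ) (hl : 0 < l) (hlL : l ≤ L)
    (hF : ∀ (lam : M) (x : EuclideanSpace ℂ (Fin (k + 1))),
      l * ‖x‖ ^ d ≤ ‖F lam x‖ ∧ ‖F lam x‖ ≤ L * ‖x‖ ^ d)
    (hFc : Continuous fun q : M × EuclideanSpace ℂ (Fin (k + 1)) => F q.1 q.2)
    (hhol : ∀ lam : M, Differentiable ℂ (F lam))
    (hhom : ∀ (lam : M) (c : ℂ) (x : EuclideanSpace ℂ (Fin (k + 1))),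
      F lam (c • x) = c ^ d • F lam x)
    (G : M → EuclideanSpace ℂ (Fin (k + 1)) → ℝ)
    (hG : ∀ (lam : M) (x : EuclideanSpace ℂ (Fin (k + 1))), x ≠ 0 →
      Tendsto (fun n => (1 / (d : ℝ) ^ n) * Real.log ‖fiter σ F n lam x‖) atTop
        (𝓝 (G lam x))) :
    ∀ lam : M,
      {x : EuclideanSpace ℂ (Fin (k + 1)) |
          Tendsto (fun n => fiter σ F n lam x) atTop (𝓝 0)} =
      {x : EuclideanSpace ℂ (Fin (k + 1)) | x = 0 ∨ G lam x < 0} := by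
  intro lam
  have hL : 0 < L := hl.trans_le hlL
  have hd1 : (1 : ℝ) < d := by exact_mod_cast hd
  have hF0 : ∀ mu, F mu 0 = 0 := fun mu => by
    have := (hF mu 0).2
    rwa [norm_zero, zero_pow (by omega), mul_zero, norm_le_zero_iff] at this
  ext x
  simp only [Set.mem_ofPred_eq]
  rcases eq_or_ne x 0 with rfl | hx
  · have hzero : ∀ n, fiter σ F n lam 0 = 0 := fun n => by
      induction n with
      | zero => rfl
      | succ n ih => rw [fiter_succ_apply, ih, hF0]
    simp [hzero]
  have hpos : ∀ n, 0 < ‖fiter σ F n lam x‖ := fun n => by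
    induction n with
    | zero => exact norm_pos_iff.2 hx
    | succ n ih =>
      rw [fiter_succ_apply]
      exact lt_of_lt_of_le (by positivity) (hF _ _).1
  have hlog : ∀ n, Real.log ‖fiter σ F (n + 1) lam x‖ ≤
      Real.log L + d * Real.log ‖fiter σ F n lam x‖ := fun n => by
    have hn := hpos n
    rw [← Real.log_pow, ← Real.log_mul hL.ne' (by positivity)]
    refine Real.log_le_log (hpos _) ?_
    rw [fiter_succ_apply]
    exact (hF _ _).2
  simp only [hx, false_or]
  constructor
  · intro h
    refine neg_of_tendsto_div_pow_of_tendsto_atBot hd1 hlog ?_ (hG lam x hx)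
    refine Real.tendsto_log_nhdsGT_zero.comp (tendsto_nhdsWithin_iff.2 ⟨?_, .of_forall hpos⟩)
    exact tendsto_zero_iff_norm_tendsto_zero.1 h
  · intro h
    rw [tendsto_zero_iff_norm_tendsto_zero]
    refine (Real.tendsto_exp_atBot.comp
      (tendsto_atBot_of_tendsto_div_pow_neg hd1 (hG lam x hx) h)).congr fun n => ?_
    exact Real.exp_log (hpos n)
end
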